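/- arXiv:math/0605225 — 2 statements merged into one kernel-verified Lean document; each statement's English description precedes it below -/
import Mathlib

section
/- Let A be a Henselian local ring that is a ℚ-algebra, with residue field κ and residue map π : A → κ. Let F ⊆ A be a subfield on which π is injective, put F' = π(F), and let α ∈ κ be a nonzero element algebraic over F' with monic minimal polynomial f̄ ∈ F'[X]. Let f ∈ F[X] be the monic polynomial obtained by applying the inverse of π|_F to the coefficients of f̄. Then there exists a ∈ A such that f(a) = 0, a is a simple root of f (i.e. f'(a) is a unit of A), π(a) = α, and f is the minimal polynomial of a over F (so a is algebraic over F). -/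
/-- In a Henselian local `ℚ`-algebra `A`, a simple root of the reduction
of a monic polynomial lifts: if `F ⊆ A` is a subfield mapped isomorphically by the residue
map `π` onto `F' = π(F)`, `α ∈ κ` is nonzero and algebraic over `F'` with monic minimal
polynomial `f̄`, and `f` is the monic lift of `f̄` with coefficients in `F`, then there is
`a ∈ A` with `f(a) = 0`, `f'(a)` a unit, `π(a) = α`, and `f` the minimal polynomial of `a`
over `F`. -/
theorem statement_2 (A : Type*) [CommRing A] [HenselianLocalRing A] [Algebra ℚ A]
    (F : Subring A) (hF : IsField F)
    (hinj : Set.InjOn (IsLocalRing.residue A) (F : Set A))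
    (α : IsLocalRing.ResidueField A) (hα : α ≠ 0)
    (fbar : Polynomial (IsLocalRing.ResidueField A))
    (hbar_coeff : ∀ i, fbar.coeff i ∈ F.map (IsLocalRing.residue A))
    (hbar_monic : fbar.Monic)
    (hbar_root : Polynomial.eval α fbar = 0)
    (hbar_min : ∀ g : Polynomial (IsLocalRing.ResidueField A),
      (∀ i, g.coeff i ∈ F.map (IsLocalRing.residue A)) → g ≠ 0 →
      Polynomial.eval α g = 0 → fbar.degree ≤ g.degree)
    (f : Polynomial A) (hf_monic : f.Monic) (hf_coeff : ∀ i, f.coeff i ∈ F)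
    (hf_map : f.map (IsLocalRing.residue A) = fbar) :
    ∃ a : A, Polynomial.eval a f = 0 ∧
      IsUnit (Polynomial.eval a (Polynomial.derivative f)) ∧
      IsLocalRing.residue A a = α ∧
      (∀ g : Polynomial A, (∀ i, g.coeff i ∈ F) → g ≠ 0 →
        Polynomial.eval a g = 0 → f.degree ≤ g.degree) := by
  have hchar : CharZero (IsLocalRing.ResidueField A) :=
    algebraRat.charZero (IsLocalRing.ResidueField A)
  have hsep : Polynomial.eval α (Polynomial.derivative fbar) ≠ 0 := by
    intro h
    have hder : Polynomial.derivative fbar ≠ 0 := by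
      intro h0
      have h1 : fbar = 1 := hbar_monic.natDegree_eq_zero.mp
        (Polynomial.derivative_eq_zero.mp h0)
      simp [h1] at hbar_root
    have hcoeff : ∀ i, (Polynomial.derivative fbar).coeff i ∈
        F.map (IsLocalRing.residue A) := by
      intro i
      rw [Polynomial.coeff_derivative]
      exact mul_mem (hbar_coeff _) (add_mem (natCast_mem _ i) (one_mem _))
    exact absurd (hbar_min _ hcoeff hder h)
      (not_le.mpr (Polynomial.degree_derivative_lt hbar_monic.ne_zero))
  have heval : ∀ (p : Polynomial A) (x : A),
      IsLocalRing.residue A (p.eval x) =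
        (p.map (IsLocalRing.residue A)).eval (IsLocalRing.residue A x) := fun p x =>
    (Polynomial.eval_map_apply _ x).symm
  have hder_unit : ∀ x : A, IsLocalRing.residue A x = α →
      IsUnit (Polynomial.eval x (Polynomial.derivative f)) := by
    intro x hx
    rwa [← IsLocalRing.residue_ne_zero_iff_isUnit, heval, ← Polynomial.derivative_map,
      hf_map, hx]
  obtain ⟨a₀, ha₀⟩ := IsLocalRing.residue_surjective α
  obtain ⟨a, ha, haa₀⟩ := HenselianLocalRing.is_henselian f hf_monic a₀
    (by rw [← IsLocalRing.residue_eq_zero_iff, heval, hf_map, ha₀, hbar_root])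
    (hder_unit a₀ ha₀)
  have haα : IsLocalRing.residue A a = α := by
    rw [← IsLocalRing.residue_eq_zero_iff, map_sub, sub_eq_zero] at haa₀
    exact haa₀.trans ha₀
  refine ⟨a, ha, hder_unit a haα, haα, fun g hg hg0 hga => ?_⟩
  have hmap_ne : g.map (IsLocalRing.residue A) ≠ 0 := by
    contrapose! hg0
    ext i
    refine hinj (hg i) F.zero_mem ?_
    rw [← Polynomial.coeff_map, hg0, Polynomial.coeff_zero, Polynomial.coeff_zero, map_zero]
  calc f.degree = fbar.degree := by rw [← hf_map, hf_monic.degree_map]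
    _ ≤ (g.map (IsLocalRing.residue A)).degree :=
      hbar_min _ (fun i => ⟨g.coeff i, hg i, (Polynomial.coeff_map _ i).symm⟩) hmap_ne
        (by rw [← haα, ← heval, hga, map_zero])
    _ ≤ g.degree := Polynomial.degree_map_le
end

section
/- Let A be a Henselian local ring that is a ℚ-algebra, with residue field κ and residue map π : A → κ. Let F ⊆ A be a subfield on which π is injective, and let σ₀ : π(F) → A be the inverse of π|_F. Let α ∈ κ be algebraic over π(F). Then there exists a ring homomorphism σ : κ → A such that π ∘ σ = id_κ, σ extends σ₀ (i.e. σ(π(x)) = x for all x ∈ F), and σ(α) is algebraic over F. -/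
open Polynomial IsLocalRing in
/-- Hensel lifting for an element of the residue field over a coefficient field of characteristic
zero: the lift annihilates the minimal polynomial (which is `0` for a transcendental element). -/
theorem exists_residue_eq_and_aeval_minpoly_eq_zero {A K : Type*} [CommRing A]
    [HenselianLocalRing A] [Field K] [CharZero K] [Algebra K A] (x : ResidueField A) :
    ∃ a : A, residue A a = x ∧ aeval a (minpoly K x) = 0 := by
  obtain ⟨a₀, rfl⟩ := residue_surjective x
  by_cases hx : IsIntegral K (residue A a₀)
  · have hres (q : K[X]) : residue A (aeval a₀ q) = aeval (residue A a₀) q :=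
      (aeval_algebraMap_apply (ResidueField A) a₀ q).symm
    obtain ⟨a, ha, hsub⟩ := HenselianLocalRing.is_henselian
      ((minpoly K (residue A a₀)).map (algebraMap K A)) ((minpoly.monic hx).map _) a₀
      (by rw [eval_map_algebraMap, ← residue_eq_zero_iff, hres, minpoly.aeval])
      (by
        rw [derivative_map, eval_map_algebraMap, ← residue_ne_zero_iff_isUnit, hres]
        exact (minpoly.irreducible hx).separable.aeval_derivative_ne_zero (minpoly.aeval _ _))
    refine ⟨a, ?_, by rwa [IsRoot, eval_map_algebraMap] at ha⟩
    rwa [← residue_eq_zero_iff, map_sub, sub_eq_zero] at hsub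
  · exact ⟨a₀, rfl, by rw [minpoly.eq_zero hx, map_zero]⟩

namespace Subring

open Polynomial IsLocalRing

variable {A : Type*} [CommRing A]

/-- The elements of `A` that are fractions with numerator in `S` and nonzero residue denominator
in `S`. -/
def residueFractions [IsLocalRing A] (S : Subring A) : Subring A where
  carrier := {a | ∃ s ∈ S, residue A s ≠ 0 ∧ a * s ∈ S}
  one_mem' := ⟨1, S.one_mem, by simp, by simp⟩
  zero_mem' := ⟨1, S.one_mem, by simp, by simp⟩
  mul_mem' := by
    rintro a b ⟨s, hs, hs0, has⟩ ⟨t, ht, ht0, hbt⟩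
    refine ⟨s * t, S.mul_mem hs ht, by simp [hs0, ht0], ?_⟩
    rw [mul_mul_mul_comm]
    exact S.mul_mem has hbt
  add_mem' := by
    rintro a b ⟨s, hs, hs0, has⟩ ⟨t, ht, ht0, hbt⟩
    refine ⟨s * t, S.mul_mem hs ht, by simp [hs0, ht0], ?_⟩
    rw [show (a + b) * (s * t) = a * s * t + b * t * s by ring]
    exact S.add_mem (S.mul_mem has ht) (S.mul_mem hbt hs)
  neg_mem' := by
    rintro a ⟨s, hs, hs0, has⟩
    exact ⟨s, hs, hs0, by simpa using S.neg_mem has⟩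

theorem le_residueFractions [IsLocalRing A] (S : Subring A) : S ≤ S.residueFractions :=
  fun a ha ↦ ⟨1, S.one_mem, by simp, by simpa using ha⟩

theorem eq_zero_of_mem_residueFractions [IsLocalRing A] {S : Subring A}
    (hS : ∀ a ∈ S, residue A a = 0 → a = 0) :
    ∀ a ∈ S.residueFractions, residue A a = 0 → a = 0 := by
  rintro a ⟨s, -, hs0, has⟩ ha
  exact (((residue_ne_zero_iff_isUnit s).1 hs0).mul_left_eq_zero).1
    (hS _ has (by rw [map_mul, ha, zero_mul]))

theorem isField_of_residueFractions_le [IsLocalRing A] {S : Subring A}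
    (hS : ∀ a ∈ S, residue A a = 0 → a = 0) (hle : S.residueFractions ≤ S) : IsField S where
  exists_pair_ne := exists_pair_ne S
  mul_comm := mul_comm
  mul_inv_cancel {a} ha := by
    have ha0 : residue A (a : A) ≠ 0 := fun h ↦ ha (Subtype.ext (hS _ a.2 h))
    obtain ⟨b, hb⟩ := ((residue_ne_zero_iff_isUnit (a : A)).1 ha0).exists_right_inv
    have hbS : b ∈ S := hle ⟨a, a.2, ha0, by rw [mul_comm, hb]; exact S.one_mem⟩
    exact ⟨⟨b, hbS⟩, Subtype.ext hb⟩

/-- Over a coefficient field of characteristic zero in a Henselian local ring, every residue class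
has a representative `a` such that `S[a]` still meets the maximal ideal trivially. -/
theorem exists_le_residue_eq [HenselianLocalRing A] [CharZero A] {S : Subring A}
    (hS : IsField S) (x : ResidueField A) :
    ∃ T : Subring A, S ≤ T ∧ (∀ a ∈ T, residue A a = 0 → a = 0) ∧ ∃ a ∈ T, residue A a = x := by
  let _ : Field S := hS.toField
  have : CharZero S := ⟨fun m n h ↦ by simpa using congrArg (Subtype.val : S → A) h⟩
  obtain ⟨a, rfl, ha⟩ := exists_residue_eq_and_aeval_minpoly_eq_zero (K := S) x
  refine ⟨(aeval (R := S) a).range.toSubring, fun s hs ↦ ⟨C ⟨s, hs⟩, by simp; rfl⟩, ?_,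
    a, ⟨X, by simp⟩, rfl⟩
  rintro _ ⟨p, rfl⟩ hp
  have hp : aeval (residue A a) p = 0 :=
    (aeval_algebraMap_apply (ResidueField A) a p).trans hp
  obtain ⟨q, rfl⟩ := minpoly.dvd S _ hp
  change aeval a _ = 0
  rw [map_mul, ha, zero_mul]

/-- A subring of a Henselian local ring of residue characteristic zero that meets the maximal ideal
trivially is contained in a coefficient field. -/
theorem exists_le_bijective_residue [HenselianLocalRing A] [CharZero A] (F : Subring A)
    (hF : ∀ a ∈ F, residue A a = 0 → a = 0) :
    ∃ S : Subring A, F ≤ S ∧ Function.Bijective ((residue A).comp S.subtype) := by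
  obtain ⟨S, hFS, hmax⟩ := zorn_le_nonempty₀ {S : Subring A | ∀ a ∈ S, residue A a = 0 → a = 0}
    (fun c hc hchain T hT ↦ by
      refine ⟨sSup c, fun a ha ↦ ?_, fun S hS ↦ le_sSup hS⟩
      obtain ⟨S, hS, haS⟩ := (mem_sSup_of_directedOn ⟨T, hT⟩ hchain.directedOn).1 ha
      exact hc hS a haS) F hF
  have hS : ∀ a ∈ S, residue A a = 0 → a = 0 := hmax.prop
  have hfield := isField_of_residueFractions_le hS
    (hmax.le_of_ge (eq_zero_of_mem_residueFractions hS) S.le_residueFractions)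
  refine ⟨S, hFS, (injective_iff_map_eq_zero _).2 fun a ha ↦ Subtype.ext (hS a a.2 ha),
    fun x ↦ ?_⟩
  obtain ⟨T, hST, hT, a, haT, rfl⟩ := exists_le_residue_eq hfield x
  exact ⟨⟨a, hmax.le_of_ge hT hST haT⟩, rfl⟩

end Subring


/-- Let `A` be a Henselian local `ℚ`-algebra with residue map `π`, let
`F ⊆ A` be a subfield mapped isomorphically onto `π(F)`, with inverse `σ₀`, and let
`α ∈ κ` be algebraic over `π(F)`.  Then there is a ring section `σ : κ → A` of `π`
extending `σ₀` such that `σ(α)` is algebraic over `F`. -/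
theorem statement_3 (A : Type*) [CommRing A] [HenselianLocalRing A] [Algebra ℚ A]
    (F : Subring A) (hF : IsField F)
    (hinj : Set.InjOn (IsLocalRing.residue A) (F : Set A))
    (α : IsLocalRing.ResidueField A)
    (halg : ∃ p : Polynomial (IsLocalRing.ResidueField A), p ≠ 0 ∧
      (∀ i, p.coeff i ∈ F.map (IsLocalRing.residue A)) ∧ Polynomial.eval α p = 0) :
    ∃ σ : IsLocalRing.ResidueField A →+* A,
      (IsLocalRing.residue A).comp σ = RingHom.id (IsLocalRing.ResidueField A) ∧
      (∀ x ∈ F, σ (IsLocalRing.residue A x) = x) ∧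
      ∃ p : Polynomial A, p ≠ 0 ∧ (∀ i, p.coeff i ∈ F) ∧
        Polynomial.eval (σ α) p = 0 := by
  have : CharZero A := algebraRat.charZero A
  obtain ⟨S, hFS, hS⟩ := F.exists_le_bijective_residue fun a ha h ↦
    hinj ha F.zero_mem (h.trans (map_zero _).symm)
  let e := RingEquiv.ofBijective _ hS
  let σ : IsLocalRing.ResidueField A →+* A := S.subtype.comp e.symm.toRingHom
  have hσ : ∀ x ∈ F, σ (IsLocalRing.residue A x) = x := fun x hx ↦
    congrArg Subtype.val (e.symm_apply_apply ⟨x, hFS hx⟩)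
  obtain ⟨p, hp0, hpF, hpα⟩ := halg
  refine ⟨σ, RingHom.ext e.apply_symm_apply, hσ, p.map σ,
    (Polynomial.map_ne_zero_iff σ.injective).2 hp0, fun i ↦ ?_, ?_⟩
  · obtain ⟨x, hx, hxi⟩ := hpF i
    rw [Polynomial.coeff_map, ← hxi, hσ x hx]
    exact hx
  · rw [Polynomial.eval_map_apply, hpα, map_zero]
end
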